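/- arXiv:1304.0371 — 2 statements merged into one kernel-verified Lean document; each statement's English description precedes it below -/
import Mathlib

section
/- Let n ≥ 1 and let f : (ZMod 2)^n → ℝ be a Boolean function (f(x) ∈ {−1,1} for all x) with spectral norm ‖f̂‖₁ = A. Then f can be computed by a parity decision tree whose size s satisfies (s : ℝ) ≤ 2^{A²} · n^{2A}. -/
/-- The character `χ_α(x) = (-1)^{⟨α,x⟩}` on the Boolean cube `(ZMod 2)^n`. -/
noncomputable def chi {n : ℕ} (α x : Fin n → ZMod 2) : ℝ :=
  if (∑ i, α i * x i : ZMod 2) = 0 then 1 else -1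

/-- The Fourier coefficient `f̂(α) = 2^{-n} ∑_x f(x) χ_α(x)`. -/
noncomputable def fhat {n : ℕ} (f : (Fin n → ZMod 2) → ℝ) (α : Fin n → ZMod 2) : ℝ :=
  (2 ^ n : ℝ)⁻¹ * ∑ x : Fin n → ZMod 2, f x * chi α x

/-- Parity decision trees over `(ZMod 2)^n`: internal nodes are labeled by linear
functions `α`, leaves by `±1` (encoded by a `Bool`). -/
inductive PDT (n : ℕ) : Type where
  | leaf (b : Bool) : PDT n
  | node (α : Fin n → ZMod 2) (t₀ t₁ : PDT n) : PDT n

namespace PDT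

/-- Evaluation of a parity decision tree on an input `x`: at a node labeled `α`
we go left if `⟨α,x⟩ = 0` and right if `⟨α,x⟩ = 1`; a leaf labeled `b` outputs
`1` or `-1`. -/
noncomputable def eval {n : ℕ} : PDT n → (Fin n → ZMod 2) → ℝ
  | leaf b, _ => if b then 1 else -1
  | node α t₀ t₁, x => if (∑ i, α i * x i : ZMod 2) = 0 then t₀.eval x else t₁.eval x

/-- The size of a parity decision tree = its number of leaves. -/
def size {n : ℕ} : PDT n → ℕ
  | leaf _ => 1
  | node _ t₀ t₁ => t₀.size + t₁.size

/-- The depth of a parity decision tree = maximal number of internal nodes on a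
root-to-leaf path. -/
def depth {n : ℕ} : PDT n → ℕ
  | leaf _ => 0
  | node _ t₀ t₁ => max t₀.depth t₁.depth + 1

end PDT

namespace PDT

section Characters

variable {n : ℕ}

lemma zmod_two_eq_zero_or_one (a : ZMod 2) : a = 0 ∨ a = 1 := by
  revert a; decide

lemma zmod_two_add_self (a : ZMod 2) : a + a = 0 := by
  revert a; decide

lemma cube_add_self (α : Fin n → ZMod 2) : α + α = 0 :=
  funext fun i => zmod_two_add_self (α i)

lemma cube_add_add_cancel (α δ : Fin n → ZMod 2) : α + δ + δ = α := by
  rw [add_assoc, cube_add_self, add_zero]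

lemma cube_exists_eq_one {δ : Fin n → ZMod 2} (hδ : δ ≠ 0) : ∃ i, δ i = 1 := by
  obtain ⟨i, hi⟩ := Function.ne_iff.mp hδ
  exact ⟨i, (zmod_two_eq_zero_or_one _).resolve_left hi⟩

lemma chi_comm (α x : Fin n → ZMod 2) : chi α x = chi x α := by
  simp [chi, mul_comm]

lemma chi_add_right (α x y : Fin n → ZMod 2) : chi α (x + y) = chi α x * chi α y := by
  unfold chi
  simp only [Pi.add_apply, mul_add, Finset.sum_add_distrib]
  generalize (∑ i, α i * x i : ZMod 2) = a
  generalize (∑ i, α i * y i : ZMod 2) = b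
  rcases zmod_two_eq_zero_or_one a with rfl | rfl <;>
    rcases zmod_two_eq_zero_or_one b with rfl | rfl <;> simp [zmod_two_add_self]

lemma chi_add_left (α β x : Fin n → ZMod 2) : chi (α + β) x = chi α x * chi β x := by
  rw [chi_comm, chi_add_right, chi_comm x, chi_comm x]

@[simp] lemma chi_zero_left (x : Fin n → ZMod 2) : chi 0 x = 1 := by simp [chi]

@[simp] lemma chi_zero_right (α : Fin n → ZMod 2) : chi α 0 = 1 := by simp [chi]

lemma chi_eq_or (α x : Fin n → ZMod 2) : chi α x = 1 ∨ chi α x = -1 := by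
  unfold chi; split_ifs <;> simp

lemma abs_chi (α x : Fin n → ZMod 2) : |chi α x| = 1 := by
  rcases chi_eq_or α x with h | h <;> simp [h]

lemma chi_single (α : Fin n → ZMod 2) (i : Fin n) :
    chi α (Pi.single i 1) = if α i = 0 then 1 else -1 := by
  simp [chi, Pi.single_apply]

lemma sum_chi (α : Fin n → ZMod 2) :
    ∑ x, chi α x = if α = 0 then (2 : ℝ) ^ n else 0 := by
  split_ifs with h
  · simp [h, ZMod.card]
  · obtain ⟨i, hi⟩ := cube_exists_eq_one h
    have key : ∑ x, chi α x = ∑ x, -chi α x := by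
      rw [← Equiv.sum_comp (Equiv.addRight (Pi.single i 1)) (chi α)]
      refine Finset.sum_congr rfl fun x _ => ?_
      simp [chi_add_right, chi_single, hi]
    rw [Finset.sum_neg_distrib] at key
    linarith

end Characters

section FourierSums

variable {n : ℕ}

/-- The real function on the cube with Fourier coefficients `c`. -/
noncomputable def fourierSum (c : (Fin n → ZMod 2) → ℝ) (x : Fin n → ZMod 2) : ℝ :=
  ∑ α, c α * chi α x

lemma fourierSum_fhat (f : (Fin n → ZMod 2) → ℝ) : fourierSum (fhat f) = f := by
  funext x
  have h1 : fourierSum (fhat f) x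
      = (2 ^ n : ℝ)⁻¹ * ∑ y, f y * ∑ α, chi (y + x) α := by
    simp only [fourierSum, fhat, mul_assoc, ← Finset.mul_sum, Finset.sum_mul]
    rw [Finset.sum_comm]
    congr 1
    refine Finset.sum_congr rfl fun y _ => ?_
    rw [Finset.mul_sum]
    refine Finset.sum_congr rfl fun α _ => ?_
    rw [chi_comm (y + x), chi_add_right]
  have h2 : ∀ y, (y + x = 0) ↔ y = x := fun y =>
    ⟨fun h => by rw [← cube_add_add_cancel y x, h, zero_add], fun h => by rw [h, cube_add_self]⟩
  rw [h1]
  simp only [sum_chi, h2, mul_ite, mul_zero, Finset.sum_ite_eq', Finset.mem_univ, if_true]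
  field_simp

lemma abs_fourierSum_le (c : (Fin n → ZMod 2) → ℝ) (x : Fin n → ZMod 2) :
    |fourierSum c x| ≤ ∑ α, |c α| := by
  refine (Finset.abs_sum_le_sum_abs _ _).trans_eq (Finset.sum_congr rfl fun α _ => ?_)
  rw [abs_mul, abs_chi, mul_one]

lemma one_le_sum_abs {c : (Fin n → ZMod 2) → ℝ}
    (hc : ∀ x, fourierSum c x = 1 ∨ fourierSum c x = -1) : 1 ≤ ∑ α, |c α| := by
  refine le_trans ?_ (abs_fourierSum_le c 0)
  rcases hc 0 with h | h <;> simp [h]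

/-- The autocorrelation of the spectrum of a Boolean function vanishes away from `0`. -/
lemma sum_mul_shift {c : (Fin n → ZMod 2) → ℝ}
    (hc : ∀ x, fourierSum c x = 1 ∨ fourierSum c x = -1) (δ : Fin n → ZMod 2) :
    ∑ γ, c γ * c (γ + δ) = if δ = 0 then 1 else 0 := by
  have h1 : ∑ x, fourierSum c x * fourierSum c x * chi δ x = ∑ x, chi δ x := by
    refine Finset.sum_congr rfl fun x _ => ?_
    rcases hc x with h | h <;> simp [h]
  have h2 : ∑ x, fourierSum c x * fourierSum c x * chi δ x
      = ∑ α, ∑ β, c α * c β * ∑ x, chi (β + (α + δ)) x := by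
    simp only [fourierSum, Finset.sum_mul, Finset.mul_sum]
    rw [Finset.sum_comm]
    refine Finset.sum_congr rfl fun α _ => ?_
    rw [Finset.sum_comm]
    refine Finset.sum_congr rfl fun β _ => Finset.sum_congr rfl fun x _ => ?_
    rw [chi_add_left, chi_add_left]
    ring
  have h3 : ∀ α β : Fin n → ZMod 2, β + (α + δ) = 0 ↔ β = α + δ := fun α β =>
    ⟨fun h => by rw [← cube_add_add_cancel β (α + δ), h, zero_add],
      fun h => by rw [h, cube_add_self]⟩
  rw [h2] at h1
  simp only [sum_chi, h3, mul_ite, mul_zero, Finset.sum_ite_eq', Finset.mem_univ, if_true,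
    ← Finset.sum_mul] at h1
  have h4 : (2 : ℝ) ^ n ≠ 0 := by positivity
  split_ifs at h1 ⊢
  · exact mul_right_cancel₀ h4 (h1.trans (one_mul _).symm)
  · exact (mul_eq_zero.mp h1).resolve_right h4

lemma sum_eq_sum_pairs (h : (Fin n → ZMod 2) → ℝ) {δ : Fin n → ZMod 2} {i : Fin n}
    (hi : δ i = 1) :
    ∑ γ, h γ = ∑ γ, if γ i = 0 then h γ + h (γ + δ) else 0 := by
  have h1 : ∀ γ : Fin n → ZMod 2, (if γ i = 0 then h γ + h (γ + δ) else 0)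
      = (if γ i = 0 then h γ else 0) + (if γ i = 0 then h (γ + δ) else 0) := by
    intro γ; split_ifs <;> simp
  have h2 : ∑ γ, (if γ i = 0 then h (γ + δ) else 0) = ∑ γ, if γ i = 0 then 0 else h γ := by
    rw [← Equiv.sum_comp (Equiv.addRight δ) (fun γ => if γ i = 0 then 0 else h γ)]
    refine Finset.sum_congr rfl fun γ _ => ?_
    rcases zmod_two_eq_zero_or_one (γ i) with h0 | h0 <;> simp [h0, hi, zmod_two_add_self]
  simp only [h1, Finset.sum_add_distrib, h2]
  rw [← Finset.sum_add_distrib]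
  refine Finset.sum_congr rfl fun γ _ => ?_
  split_ifs <;> simp

lemma fourierSum_congr {c : (Fin n → ZMod 2) → ℝ} {S : Finset (Fin n)}
    (hS : ∀ α, c α ≠ 0 → ∀ i, i ∉ S → α i = 0) {x y : Fin n → ZMod 2}
    (hxy : ∀ i ∈ S, x i = y i) : fourierSum c x = fourierSum c y := by
  refine Finset.sum_congr rfl fun α _ => ?_
  by_cases hα : c α = 0
  · simp [hα]
  · have : (∑ i, α i * x i : ZMod 2) = ∑ i, α i * y i := by
      refine Finset.sum_congr rfl fun i _ => ?_
      by_cases hi : i ∈ S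
      · rw [hxy i hi]
      · simp [hS α hα i hi]
    simp only [chi, this]

end FourierSums

section Restriction

variable {n : ℕ}

/-- The spectrum of the restriction of a function with spectrum `c` to the hyperplane `χ_δ = ε`,
written without the coordinate `i` (where `δ i = 1`). -/
noncomputable def restrictSpec (c : (Fin n → ZMod 2) → ℝ) (δ : Fin n → ZMod 2) (i : Fin n)
    (ε : ℝ) (γ : Fin n → ZMod 2) : ℝ :=
  if γ i = 0 then c γ + ε * c (γ + δ) else 0

lemma fourierSum_restrictSpec (c : (Fin n → ZMod 2) → ℝ) {δ : Fin n → ZMod 2} {i : Fin n}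
    (hi : δ i = 1) (x : Fin n → ZMod 2) :
    fourierSum (restrictSpec c δ i (chi δ x)) x = fourierSum c x := by
  unfold fourierSum
  rw [sum_eq_sum_pairs (fun α => c α * chi α x) hi]
  refine Finset.sum_congr rfl fun γ _ => ?_
  simp only [restrictSpec, chi_add_left]
  split_ifs <;> ring

lemma restrictSpec_support {c : (Fin n → ZMod 2) → ℝ} {S : Finset (Fin n)}
    (hS : ∀ α, c α ≠ 0 → ∀ i, i ∉ S → α i = 0) {δ : Fin n → ZMod 2}
    (hδ : ∀ i, i ∉ S → δ i = 0) {i : Fin n} (ε : ℝ) (γ : Fin n → ZMod 2)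
    (hγ : restrictSpec c δ i ε γ ≠ 0) (j : Fin n) (hj : j ∉ S.erase i) : γ j = 0 := by
  unfold restrictSpec at hγ
  split_ifs at hγ with h0
  · by_cases hji : j = i
    · rw [hji, h0]
    · have hjS : j ∉ S := fun h => hj (Finset.mem_erase.mpr ⟨hji, h⟩)
      by_cases hc : c γ = 0
      · have h1 : c (γ + δ) ≠ 0 := fun h => hγ (by rw [hc, h]; ring)
        simpa [hδ j hjS] using hS _ h1 j hjS
      · exact hS _ hc j hjS
  · exact absurd rfl hγ

lemma restrictSpec_boolean {c : (Fin n → ZMod 2) → ℝ}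
    (hc : ∀ x, fourierSum c x = 1 ∨ fourierSum c x = -1) {δ : Fin n → ZMod 2} {i : Fin n}
    (hi : δ i = 1) {ε : ℝ} (hε : ε = 1 ∨ ε = -1) (x : Fin n → ZMod 2) :
    fourierSum (restrictSpec c δ i ε) x = 1 ∨ fourierSum (restrictSpec c δ i ε) x = -1 := by
  by_cases h : chi δ x = ε
  · rw [← h, fourierSum_restrictSpec c hi]
    exact hc x
  · have hflip : chi δ (x + Pi.single i 1) = ε := by
      rw [chi_add_right, chi_single, hi]
      rcases hε with rfl | rfl <;> rcases chi_eq_or δ x with h' | h' <;> simp_all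
    have hinv : fourierSum (restrictSpec c δ i ε) x
        = fourierSum (restrictSpec c δ i ε) (x + Pi.single i 1) := by
      refine Finset.sum_congr rfl fun γ _ => ?_
      rw [chi_add_right, chi_single]
      by_cases h0 : γ i = 0 <;> simp [restrictSpec, h0]
    rw [hinv, ← hflip, fourierSum_restrictSpec c hi]
    exact hc _

lemma two_mul_sum_abs_restrictSpec (c : (Fin n → ZMod 2) → ℝ) {δ : Fin n → ZMod 2} {i : Fin n}
    (hi : δ i = 1) {ε : ℝ} (hε : ε = 1 ∨ ε = -1) :
    2 * ∑ γ, |restrictSpec c δ i ε γ| = ∑ γ, |c γ + ε * c (γ + δ)| := by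
  rw [sum_eq_sum_pairs (fun γ => |c γ + ε * c (γ + δ)|) hi, Finset.mul_sum]
  refine Finset.sum_congr rfl fun γ _ => ?_
  unfold restrictSpec
  split_ifs
  · have : |c (γ + δ) + ε * c γ| = |c γ + ε * c (γ + δ)| := by
      rcases hε with rfl | rfl
      · congr 1; ring
      · rw [← abs_neg]; congr 1; ring
    rw [cube_add_add_cancel, this]
    ring
  · simp

lemma sum_abs_add_shift (c : (Fin n → ZMod 2) → ℝ) (δ : Fin n → ZMod 2) :
    ∑ γ, (|c γ| + |c (γ + δ)|) = 2 * ∑ γ, |c γ| := by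
  have h := Equiv.sum_comp (Equiv.addRight δ) (fun γ => |c γ|)
  simp only [Equiv.coe_addRight] at h
  rw [Finset.sum_add_distrib, h]
  ring

lemma abs_add_of_mul_neg {a b : ℝ} (h : a * b ≤ 0) (hab : |b| ≤ |a|) : |a + b| = |a| - |b| := by
  rcases abs_cases a with ⟨h1, h1'⟩ | ⟨h1, h1'⟩ <;>
    rcases abs_cases b with ⟨h2, h2'⟩ | ⟨h2, h2'⟩ <;>
    rcases abs_cases (a + b) with ⟨h3, h3'⟩ | ⟨h3, h3'⟩ <;>
    rw [h1, h2] at hab <;> rw [h1, h2, h3] <;> nlinarith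

/-- Restricting along `α + β` with the sign for which the coefficients at `α` and `β` cancel. -/
lemma sum_abs_restrictSpec_le_of_neg {c : (Fin n → ZMod 2) → ℝ} {α β : Fin n → ZMod 2}
    {i : Fin n} (hi : (α + β) i = 1) {ε : ℝ} (hε : ε = 1 ∨ ε = -1)
    (hαβ : α ≠ β) (hle : |c β| ≤ |c α|) (hneg : ε * (c α * c β) ≤ 0) :
    ∑ γ, |restrictSpec c (α + β) i ε γ| ≤ ∑ γ, |c γ| - 2 * |c β| := by
  have habs : ∀ a : ℝ, |ε * a| = |a| := by
    intro a; rcases hε with rfl | rfl <;> simp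
  have hsα : α + (α + β) = β := by rw [← add_assoc, cube_add_self, zero_add]
  have hsβ : β + (α + β) = α := by rw [add_comm α, ← add_assoc, cube_add_self, zero_add]
  have hα : |c α + ε * c β| = |c α| - |c β| := by
    rw [abs_add_of_mul_neg (by linarith) (by rwa [habs]), habs]
  have hβ : |c β + ε * c α| = |c α| - |c β| := by
    rw [add_comm, abs_add_of_mul_neg (by linarith) (by rwa [habs]), habs]
  have hpt : ∀ γ, |c γ + ε * c (γ + (α + β))| ≤ |c γ| + |c (γ + (α + β))|
      - ((if γ = α then 2 * |c β| else 0) + (if γ = β then 2 * |c β| else 0)) := by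
    intro γ
    by_cases h1 : γ = α
    · subst h1
      rw [if_pos rfl, if_neg hαβ, hsα, hα]; linarith
    · by_cases h2 : γ = β
      · subst h2
        rw [if_pos rfl, if_neg h1, hsβ, hβ]; linarith
      · rw [if_neg h1, if_neg h2]
        have := abs_add_le (c γ) (ε * c (γ + (α + β)))
        rw [habs] at this
        linarith
  have hsum := Finset.sum_le_sum fun γ (_ : γ ∈ Finset.univ) => hpt γ
  rw [Finset.sum_sub_distrib, sum_abs_add_shift, Finset.sum_add_distrib,
    ← two_mul_sum_abs_restrictSpec c hi hε] at hsum
  simp only [Finset.sum_ite_eq', Finset.mem_univ, if_true] at hsum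
  linarith

lemma abs_add_mul_le {a b m : ℝ} (ha : |a| ≤ m) (hb : |b| ≤ m) :
    |a + b| * m ≤ (|a| + |b|) * m + 2 * (a * b) := by
  rcases abs_cases a with ⟨h1, h1'⟩ | ⟨h1, h1'⟩ <;>
    rcases abs_cases b with ⟨h2, h2'⟩ | ⟨h2, h2'⟩ <;>
    rcases abs_cases (a + b) with ⟨h3, h3'⟩ | ⟨h3, h3'⟩ <;>
    rw [h1] at ha <;> rw [h2] at hb <;> rw [h1, h2, h3] <;> nlinarith

/-- Restricting along `α + β` with the sign for which the coefficients at `α` and `β` add up: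
orthogonality forces cancellation elsewhere in the spectrum. -/
lemma sum_abs_restrictSpec_le_of_pos {c : (Fin n → ZMod 2) → ℝ} {α β : Fin n → ZMod 2}
    {i : Fin n} (hi : (α + β) i = 1) {ε : ℝ} (hε : ε = 1 ∨ ε = -1)
    (hαβ : α ≠ β) (hmax : ∀ γ, γ ≠ α → |c γ| ≤ |c β|) (hβ0 : c β ≠ 0)
    (horth : ∑ γ, c γ * c (γ + (α + β)) = 0) (hpos : 0 ≤ ε * (c α * c β)) :
    ∑ γ, |restrictSpec c (α + β) i ε γ| ≤ ∑ γ, |c γ| - 2 * |c α| := by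
  have habs : ∀ a : ℝ, |ε * a| = |a| := by
    intro a; rcases hε with rfl | rfl <;> simp
  have hsα : α + (α + β) = β := by rw [← add_assoc, cube_add_self, zero_add]
  have hsβ : β + (α + β) = α := by rw [add_comm α, ← add_assoc, cube_add_self, zero_add]
  have hprod : ε * (c α * c β) = |c α| * |c β| := by
    rw [← abs_mul, ← habs, abs_of_nonneg hpos]
  have hβpos : 0 < |c β| := abs_pos.mpr hβ0
  have hpt : ∀ γ, |c γ + ε * c (γ + (α + β))| * |c β|
      ≤ (|c γ| + |c (γ + (α + β))|) * |c β| + 2 * ε * (c γ * c (γ + (α + β)))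
      - ((if γ = α then 2 * (|c α| * |c β|) else 0)
        + (if γ = β then 2 * (|c α| * |c β|) else 0)) := by
    intro γ
    have htri := abs_add_le (c γ) (ε * c (γ + (α + β)))
    rw [habs] at htri
    have htri' := mul_le_mul_of_nonneg_right htri hβpos.le
    by_cases h1 : γ = α
    · subst h1
      rw [if_pos rfl, if_neg hαβ]
      rw [hsα] at htri' ⊢
      linarith
    · by_cases h2 : γ = β
      · subst h2
        rw [if_pos rfl, if_neg h1]
        rw [hsβ] at htri' ⊢
        linarith
      · rw [if_neg h1, if_neg h2]
        have h3 : γ + (α + β) ≠ α := fun h => h2 (by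
          rw [← cube_add_add_cancel γ (α + β), h, hsα])
        have := abs_add_mul_le (hmax γ h1) ((habs _).trans_le (hmax _ h3))
        rw [habs] at this
        linarith
  have hsum := Finset.sum_le_sum fun γ (_ : γ ∈ Finset.univ) => hpt γ
  rw [Finset.sum_sub_distrib, Finset.sum_add_distrib, ← Finset.sum_mul, ← Finset.sum_mul,
    ← Finset.mul_sum, horth, sum_abs_add_shift, Finset.sum_add_distrib,
    ← two_mul_sum_abs_restrictSpec c hi hε] at hsum
  simp only [Finset.sum_ite_eq', Finset.mem_univ, if_true] at hsum
  refine le_of_mul_le_mul_right ?_ hβpos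
  linarith

end Restriction

section SizeBound

/-- The size bound for a function of spectral norm `A` on a cube of dimension `k`. -/
noncomputable def sizeBound (k : ℕ) (A : ℝ) : ℝ := (2 : ℝ) ^ (A ^ 2) * (k : ℝ) ^ (2 * A)

lemma two_le_sizeBound {k : ℕ} (hk : 1 ≤ k) {A : ℝ} (hA : 1 ≤ A) : 2 ≤ sizeBound k A := by
  have h1 : (2 : ℝ) ≤ (2 : ℝ) ^ (A ^ 2) :=
    Real.self_le_rpow_of_one_le (by norm_num) (by nlinarith)
  have h2 : (1 : ℝ) ≤ (k : ℝ) ^ (2 * A) :=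
    Real.one_le_rpow (by exact_mod_cast hk) (by linarith)
  unfold sizeBound
  nlinarith

lemma sizeBound_mono {k : ℕ} (hk : 1 ≤ k) {A B : ℝ} (hA : 0 ≤ A) (hAB : A ≤ B) :
    sizeBound k A ≤ sizeBound k B := by
  have hk' : (1 : ℝ) ≤ k := by exact_mod_cast hk
  unfold sizeBound
  gcongr
  norm_num

lemma sizeBound_step_unbalanced {k : ℕ} (hk : 1 ≤ k) {A : ℝ} (hA : 1 ≤ A) :
    sizeBound k (A - 1) + sizeBound k A ≤ sizeBound (k + 1) A := by
  have hk' : (1 : ℝ) ≤ k := by exact_mod_cast hk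
  have hk0 : (0 : ℝ) < k := by linarith
  have h1 : (2 : ℝ) ^ ((A - 1) ^ 2) ≤ (2 : ℝ) ^ (A ^ 2) :=
    Real.rpow_le_rpow_of_exponent_le (by norm_num) (by nlinarith)
  have hP : (k : ℝ) ^ (2 * A) = (k : ℝ) ^ (2 * (A - 1)) * (k : ℝ) ^ 2 := by
    rw [← Real.rpow_natCast, ← Real.rpow_add hk0]; congr 1; push_cast; ring
  have hQ : ((k : ℝ) + 1) ^ (2 * A) = ((k : ℝ) + 1) ^ (2 * (A - 1)) * ((k : ℝ) + 1) ^ 2 := by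
    rw [← Real.rpow_natCast, ← Real.rpow_add (by linarith)]; congr 1; push_cast; ring
  have h2 : (k : ℝ) ^ (2 * (A - 1)) ≤ ((k : ℝ) + 1) ^ (2 * (A - 1)) :=
    Real.rpow_le_rpow hk0.le (by linarith) (by linarith)
  have h3 : 0 ≤ (k : ℝ) ^ (2 * (A - 1)) := by positivity
  have h4 : (0 : ℝ) ≤ (2 : ℝ) ^ (A ^ 2) := by positivity
  have h5 : (k : ℝ) ^ (2 * (A - 1)) + (k : ℝ) ^ (2 * A) ≤ ((k : ℝ) + 1) ^ (2 * A) := by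
    rw [hP, hQ]
    calc _ = (k : ℝ) ^ (2 * (A - 1)) * (1 + (k : ℝ) ^ 2) := by ring
      _ ≤ _ := mul_le_mul h2 (by nlinarith) (by positivity) (h3.trans h2)
  unfold sizeBound
  push_cast
  calc _ ≤ (2 : ℝ) ^ (A ^ 2) * (k : ℝ) ^ (2 * (A - 1)) + (2 : ℝ) ^ (A ^ 2) * (k : ℝ) ^ (2 * A) := by
        gcongr
    _ = (2 : ℝ) ^ (A ^ 2) * ((k : ℝ) ^ (2 * (A - 1)) + (k : ℝ) ^ (2 * A)) := by ring
    _ ≤ _ := by gcongr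

lemma sizeBound_step_balanced {k : ℕ} (hk : 1 ≤ k) {A : ℝ} (hA : 1 ≤ A) :
    sizeBound k (A - 1 / A) + sizeBound k (A - 1 / A) ≤ sizeBound (k + 1) A := by
  have hk' : (1 : ℝ) ≤ k := by exact_mod_cast hk
  have hinv : 0 < 1 / A := by positivity
  have hinv1 : 1 / A ≤ 1 := (div_le_one (by linarith)).mpr hA
  have hmul : A * (1 / A) = 1 := by field_simp
  have h1 : (2 : ℝ) * (2 : ℝ) ^ ((A - 1 / A) ^ 2) ≤ (2 : ℝ) ^ (A ^ 2) := by
    rw [← Real.rpow_one_add' (by norm_num) (by positivity)]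
    exact Real.rpow_le_rpow_of_exponent_le (by norm_num) (by nlinarith)
  have h2 : (k : ℝ) ^ (2 * (A - 1 / A)) ≤ ((k : ℝ) + 1) ^ (2 * A) :=
    (Real.rpow_le_rpow_of_exponent_le hk' (by linarith)).trans
      (Real.rpow_le_rpow (by linarith) (by linarith) (by linarith))
  unfold sizeBound
  push_cast
  calc _ = 2 * (2 : ℝ) ^ ((A - 1 / A) ^ 2) * (k : ℝ) ^ (2 * (A - 1 / A)) := by ring
    _ ≤ _ := by gcongr

end SizeBound

section Trees

variable {n : ℕ}

/-- The leaf with output `v`, when `v` is `1` or `-1`. -/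
noncomputable def signLeaf (n : ℕ) (v : ℝ) : PDT n :=
  open Classical in leaf (decide (v = 1))

lemma eval_signLeaf {v : ℝ} (hv : v = 1 ∨ v = -1) (x : Fin n → ZMod 2) :
    (signLeaf n v).eval x = v := by
  rcases hv with rfl | rfl
  · simp [signLeaf, eval]
  · norm_num [signLeaf, eval]

lemma exists_pdt_of_one_coordinate {c : (Fin n → ZMod 2) → ℝ} {i : Fin n}
    (hS : ∀ α, c α ≠ 0 → ∀ j, j ∉ ({i} : Finset (Fin n)) → α j = 0)
    (hc : ∀ x, fourierSum c x = 1 ∨ fourierSum c x = -1) :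
    ∃ T : PDT n, (∀ x, T.eval x = fourierSum c x) ∧ T.size = 2 := by
  refine ⟨node (Pi.single i 1) (signLeaf n (fourierSum c 0))
    (signLeaf n (fourierSum c (Pi.single i 1))), fun x => ?_, rfl⟩
  have hsum : (∑ j, (Pi.single i 1 : Fin n → ZMod 2) j * x j : ZMod 2) = x i := by
    simp [Pi.single_apply]
  simp only [eval, hsum, eval_signLeaf (hc _)]
  split_ifs with h
  · exact fourierSum_congr hS (by simp [h])
  · have h' := (zmod_two_eq_zero_or_one _).resolve_left h
    exact fourierSum_congr hS (by simp [h'])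

lemma exists_pdt_of_single_coeff {c : (Fin n → ZMod 2) → ℝ} {α : Fin n → ZMod 2}
    (hα : ∀ β, β ≠ α → c β = 0)
    (hc : ∀ x, fourierSum c x = 1 ∨ fourierSum c x = -1) :
    ∃ T : PDT n, (∀ x, T.eval x = fourierSum c x) ∧ T.size = 2 := by
  have hsum : ∀ x, fourierSum c x = c α * chi α x := fun x =>
    Finset.sum_eq_single α (fun β _ h => by rw [hα β h, zero_mul]) (by simp)
  have hcα : c α = 1 ∨ c α = -1 := by simpa [hsum] using hc 0
  have hcα' : -c α = 1 ∨ -c α = -1 := by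
    rcases hcα with h | h <;> simp [h]
  refine ⟨node α (signLeaf n (c α)) (signLeaf n (-c α)), fun x => ?_, rfl⟩
  simp only [eval, eval_signLeaf hcα, eval_signLeaf hcα', hsum, chi]
  split_ifs <;> simp

/-- The second largest coefficient of a Boolean function is bounded below when the largest one is
at most `1/2`. -/
lemma one_div_le_two_mul_abs {c : (Fin n → ZMod 2) → ℝ} {α β : Fin n → ZMod 2}
    (hsq : ∑ γ, c γ * c γ = 1) (hmax : ∀ γ, γ ≠ α → |c γ| ≤ |c β|) (hα : |c α| ≤ 1 / 2)
    (hA : 1 ≤ ∑ γ, |c γ|) : 1 / (∑ γ, |c γ|) ≤ 2 * |c β| := by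
  have hpt : ∀ γ, c γ * c γ ≤ |c β| * |c γ| + if γ = α then 1 / 4 else 0 := by
    intro γ
    rw [← abs_mul_abs_self]
    split_ifs with h
    · subst h
      nlinarith [mul_nonneg (abs_nonneg (c β)) (abs_nonneg (c γ)), abs_nonneg (c γ)]
    · have := mul_le_mul_of_nonneg_right (hmax γ h) (abs_nonneg (c γ))
      linarith
  have hsum := Finset.sum_le_sum fun γ (_ : γ ∈ Finset.univ) => hpt γ
  rw [hsq, Finset.sum_add_distrib, ← Finset.mul_sum] at hsum
  simp only [Finset.sum_ite_eq', Finset.mem_univ, if_true] at hsum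
  rw [div_le_iff₀ (by linarith)]
  linarith

/-- A nonlinear Boolean function can be split along a parity so that both restrictions have
spectral norms small enough for the recursion on the size bound. -/
lemma exists_good_split {c : (Fin n → ZMod 2) → ℝ}
    (hc : ∀ x, fourierSum c x = 1 ∨ fourierSum c x = -1)
    (hmany : ∀ α, ∃ β, β ≠ α ∧ c β ≠ 0) {k : ℕ} (hk : 1 ≤ k) :
    ∃ α β : Fin n → ZMod 2, α ≠ β ∧ c α ≠ 0 ∧ c β ≠ 0 ∧ ∀ i, (α + β) i = 1 →
      sizeBound k (∑ γ, |restrictSpec c (α + β) i 1 γ|)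
        + sizeBound k (∑ γ, |restrictSpec c (α + β) i (-1) γ|)
        ≤ sizeBound (k + 1) (∑ γ, |c γ|) := by
  obtain ⟨α, -, hα⟩ := Finset.exists_max_image Finset.univ (fun γ => |c γ|) ⟨0, Finset.mem_univ _⟩
  obtain ⟨β₀, hβ₀, hcβ₀⟩ := hmany α
  obtain ⟨β, hβmem, hβ⟩ := Finset.exists_max_image (Finset.univ.erase α) (fun γ => |c γ|)
    ⟨β₀, by simp [hβ₀]⟩
  have hαβ : α ≠ β := fun h => by simp [h] at hβmem
  have hmax : ∀ γ, γ ≠ α → |c γ| ≤ |c β| := fun γ h => hβ γ (by simp [h])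
  have hle : |c β| ≤ |c α| := hα β (Finset.mem_univ _)
  have hβpos : 0 < |c β| := (abs_pos.mpr hcβ₀).trans_le (hmax _ hβ₀)
  have hβ0 : c β ≠ 0 := abs_pos.mp hβpos
  have hα0 : c α ≠ 0 := abs_pos.mp (hβpos.trans_le hle)
  have hδ : α + β ≠ 0 := fun h => hαβ (by rw [← cube_add_add_cancel α β, h, zero_add])
  have horth : ∑ γ, c γ * c (γ + (α + β)) = 0 := by rw [sum_mul_shift hc, if_neg hδ]
  have hsq : ∑ γ, c γ * c γ = 1 := by simpa using sum_mul_shift hc 0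
  have hA := one_le_sum_abs hc
  refine ⟨α, β, hαβ, hα0, hβ0, fun i hi => ?_⟩
  have combine : ∀ B₀ B₁ : ℝ, 0 ≤ B₀ → 0 ≤ B₁ → B₀ ≤ ∑ γ, |c γ| - 2 * |c α| →
      B₁ ≤ ∑ γ, |c γ| - 2 * |c β| →
      sizeBound k B₀ + sizeBound k B₁ ≤ sizeBound (k + 1) (∑ γ, |c γ|) := by
    intro B₀ B₁ h₀ h₁ hB₀ hB₁
    rcases le_total (|c α|) (1 / 2) with h | h
    · have hsmall := one_div_le_two_mul_abs hsq hmax h hA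
      exact (add_le_add (sizeBound_mono hk h₀ (by linarith))
        (sizeBound_mono hk h₁ (by linarith))).trans (sizeBound_step_balanced hk hA)
    · exact (add_le_add (sizeBound_mono hk h₀ (by linarith))
        (sizeBound_mono hk h₁ (by linarith))).trans (sizeBound_step_unbalanced hk hA)
  have hnn : ∀ ε, 0 ≤ ∑ γ, |restrictSpec c (α + β) i ε γ| := fun ε =>
    Finset.sum_nonneg fun γ _ => abs_nonneg _
  rcases le_total 0 (c α * c β) with h | h
  · exact combine _ _ (hnn _) (hnn _)
      (sum_abs_restrictSpec_le_of_pos hi (Or.inl rfl) hαβ hmax hβ0 horth (by linarith))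
      (sum_abs_restrictSpec_le_of_neg hi (Or.inr rfl) hαβ hle (by linarith))
  · rw [add_comm]
    exact combine _ _ (hnn _) (hnn _)
      (sum_abs_restrictSpec_le_of_pos hi (Or.inr rfl) hαβ hmax hβ0 horth (by linarith))
      (sum_abs_restrictSpec_le_of_neg hi (Or.inl rfl) hαβ hle (by linarith))

theorem exists_pdt_size_le {k : ℕ} (hk : 1 ≤ k) :
    ∀ (S : Finset (Fin n)), S.card = k → ∀ c : (Fin n → ZMod 2) → ℝ,
      (∀ α, c α ≠ 0 → ∀ i, i ∉ S → α i = 0) →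
      (∀ x, fourierSum c x = 1 ∨ fourierSum c x = -1) →
      ∃ T : PDT n, (∀ x, T.eval x = fourierSum c x) ∧
        (T.size : ℝ) ≤ sizeBound k (∑ α, |c α|) := by
  induction k, hk using Nat.le_induction with
  | base =>
    intro S hS c hsupp hc
    obtain ⟨i, rfl⟩ := Finset.card_eq_one.mp hS
    obtain ⟨T, hT, hsize⟩ := exists_pdt_of_one_coordinate hsupp hc
    exact ⟨T, hT, by simpa [hsize] using two_le_sizeBound le_rfl (one_le_sum_abs hc)⟩
  | succ k hk ih =>
    intro S hS c hsupp hc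
    by_cases hmany : ∀ α, ∃ β, β ≠ α ∧ c β ≠ 0
    · obtain ⟨α, β, hαβ, hα0, hβ0, hbound⟩ := exists_good_split hc hmany hk
      have hδ : α + β ≠ 0 := fun h => hαβ (by rw [← cube_add_add_cancel α β, h, zero_add])
      have hδS : ∀ i, i ∉ S → (α + β) i = 0 := fun i hi => by
        simp [hsupp α hα0 i hi, hsupp β hβ0 i hi]
      obtain ⟨i, hi⟩ := cube_exists_eq_one hδ
      have hiS : i ∈ S := by
        by_contra h
        exact one_ne_zero (hi.symm.trans (hδS i h))
      have hcard : (S.erase i).card = k := by rw [Finset.card_erase_of_mem hiS, hS]; rfl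
      obtain ⟨T₀, hT₀, hs₀⟩ := ih (S.erase i) hcard _
        (restrictSpec_support hsupp hδS 1) (restrictSpec_boolean hc hi (Or.inl rfl))
      obtain ⟨T₁, hT₁, hs₁⟩ := ih (S.erase i) hcard _
        (restrictSpec_support hsupp hδS (-1)) (restrictSpec_boolean hc hi (Or.inr rfl))
      refine ⟨node (α + β) T₀ T₁, fun x => ?_, ?_⟩
      · rw [← fourierSum_restrictSpec c hi x]
        simp only [eval, hT₀, hT₁, chi]
        split_ifs <;> rfl
      · simp only [size, Nat.cast_add]
        exact (add_le_add hs₀ hs₁).trans (hbound i hi)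
    · push Not at hmany
      obtain ⟨α, hα⟩ := hmany
      obtain ⟨T, hT, hsize⟩ := exists_pdt_of_single_coeff hα hc
      have hbound := two_le_sizeBound (Nat.le_succ_of_le hk) (one_le_sum_abs hc)
      exact ⟨T, hT, by simpa [hsize] using hbound⟩

end Trees

end PDT

/-- **Theorem 1.2**: a Boolean function with spectral norm `A` is computed by a
parity decision tree of size at most `2^{A²} n^{2A}`. -/
theorem pdt_of_small_spectral_norm (n : ℕ) (hn : 1 ≤ n)
    (f : (Fin n → ZMod 2) → ℝ) (hf : ∀ x, f x = 1 ∨ f x = -1)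
    (A : ℝ) (hA : ∑ α : Fin n → ZMod 2, |fhat f α| = A) :
    ∃ T : PDT n, (∀ x, T.eval x = f x) ∧
      (T.size : ℝ) ≤ (2 : ℝ) ^ (A ^ 2) * (n : ℝ) ^ (2 * A) := by
  subst hA
  have h := PDT.exists_pdt_size_le hn Finset.univ (Finset.card_fin n) (fhat f)
    (fun _ _ i hi => absurd (Finset.mem_univ i) hi)
  rw [PDT.fourierSum_fhat] at h
  exact h hf
end

section
/- There is a universal constant C > 0 such that the following holds. Let f : (ZMod 2)^n → ℝ be a Boolean function (f(x) ∈ {−1,1} for all x) with spectral norm ‖f̂‖₁ ≤ A, and let 0 < ε < 1. Then there exists a Boolean function g : (ZMod 2)^n → ℝ (g(x) ∈ {−1,1} for all x) computed by a parity decision tree of depth at most C·(A² + log₂(1/ε)) and of size at most 2^{C·A²}/ε², such that the fraction of points x ∈ (ZMod 2)^n with f(x) ≠ g(x) is at most ε. -/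
section Characters

variable {n : ℕ}

theorem chi_comm (α x : Fin n → ZMod 2) : chi α x = chi x α := by
  simp [chi, mul_comm]

theorem sign_zmod_two_add (a b : ZMod 2) :
    (if a + b = 0 then (1 : ℝ) else -1) =
      (if a = 0 then 1 else -1) * (if b = 0 then 1 else -1) := by
  have key : ∀ a b : ZMod 2, (a + b = 0 ↔ (a = 0 ↔ b = 0)) := by decide
  by_cases ha : a = 0 <;> by_cases hb : b = 0 <;> simp [key, ha, hb]

theorem chi_add_right (α x y : Fin n → ZMod 2) : chi α (x + y) = chi α x * chi α y := by
  simp only [chi, Pi.add_apply, mul_add, Finset.sum_add_distrib]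
  exact sign_zmod_two_add _ _

theorem chi_add_left (α β x : Fin n → ZMod 2) : chi (α + β) x = chi α x * chi β x := by
  rw [chi_comm, chi_add_right, chi_comm x, chi_comm x]

theorem chi_eq_one_or (α x : Fin n → ZMod 2) : chi α x = 1 ∨ chi α x = -1 := by
  unfold chi
  split_ifs <;> simp

theorem chi_mul_self (α x : Fin n → ZMod 2) : chi α x * chi α x = 1 := by
  rcases chi_eq_one_or α x with h | h <;> simp [h]

theorem add_self_cube (x : Fin n → ZMod 2) : x + x = 0 := by
  ext i
  exact CharTwo.add_self_eq_zero _

theorem add_add_cancel_cube (x v : Fin n → ZMod 2) : x + v + v = x := by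
  rw [add_assoc, add_self_cube, add_zero]

theorem add_eq_zero_cube {x y : Fin n → ZMod 2} : x + y = 0 ↔ x = y := by
  constructor
  · intro h
    rw [← add_add_cancel_cube x y, h, zero_add]
  · rintro rfl
    exact add_self_cube _

theorem exists_chi_eq_neg_one {α : Fin n → ZMod 2} (hα : α ≠ 0) : ∃ v, chi α v = -1 := by
  obtain ⟨i, hi⟩ := Function.ne_iff.mp hα
  refine ⟨Pi.single i 1, ?_⟩
  have hi' : α i ≠ 0 := hi
  simp [chi, Pi.single_apply, hi']

theorem sum_comp_add_right (v : Fin n → ZMod 2) (F : (Fin n → ZMod 2) → ℝ) :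
    ∑ x, F (x + v) = ∑ x, F x :=
  Equiv.sum_comp (Equiv.addRight v) F

theorem sum_chi_of_ne_zero {α : Fin n → ZMod 2} (hα : α ≠ 0) : ∑ x, chi α x = 0 := by
  obtain ⟨v, hv⟩ := exists_chi_eq_neg_one hα
  have h := sum_comp_add_right v (chi α)
  simp only [chi_add_right, hv, mul_neg, mul_one, Finset.sum_neg_distrib] at h
  linarith

theorem card_cube : (Fintype.card (Fin n → ZMod 2) : ℝ) = 2 ^ n := by
  simp [ZMod.card]

theorem sum_chi_add_left (x y : Fin n → ZMod 2) :
    ∑ γ, chi γ (x + y) = if x = y then (2 : ℝ) ^ n else 0 := by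
  simp only [chi_comm _ (x + y)]
  split_ifs with h
  · have h0 : x + y = 0 := add_eq_zero_cube.mpr h
    rw [h0, ← card_cube]
    simp [chi]
  · exact sum_chi_of_ne_zero (fun h0 => h (add_eq_zero_cube.mp h0))

end Characters

section Fourier

variable {n : ℕ}

/-- The spectral norm `∑_α |f̂(α)|`. -/
noncomputable def spectralNorm₁ (f : (Fin n → ZMod 2) → ℝ) : ℝ := ∑ α, |fhat f α|

theorem sum_fhat_mul_fhat_add (f : (Fin n → ZMod 2) → ℝ) (δ : Fin n → ZMod 2) :
    ∑ γ, fhat f γ * fhat f (γ + δ) = (2 ^ n : ℝ)⁻¹ * ∑ x, f x ^ 2 * chi δ x := by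
  have h2 : (2 : ℝ) ^ n ≠ 0 := by positivity
  calc ∑ γ, fhat f γ * fhat f (γ + δ)
      = ∑ γ, ∑ x, ∑ y, ((2 ^ n : ℝ)⁻¹ * (2 ^ n : ℝ)⁻¹ * (f x * f y * chi δ y)) *
          chi γ (x + y) := by
        refine Finset.sum_congr rfl fun γ _ => ?_
        unfold fhat
        rw [mul_mul_mul_comm, Finset.sum_mul_sum, Finset.mul_sum]
        refine Finset.sum_congr rfl fun x _ => ?_
        rw [Finset.mul_sum]
        refine Finset.sum_congr rfl fun y _ => ?_
        rw [chi_add_left, chi_add_right]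
        ring
    _ = ∑ x, ∑ y, ((2 ^ n : ℝ)⁻¹ * (2 ^ n : ℝ)⁻¹ * (f x * f y * chi δ y)) *
          ∑ γ, chi γ (x + y) := by
        rw [Finset.sum_comm]
        refine Finset.sum_congr rfl fun x _ => ?_
        rw [Finset.sum_comm]
        simp only [Finset.mul_sum]
    _ = (2 ^ n : ℝ)⁻¹ * ∑ x, f x ^ 2 * chi δ x := by
        rw [Finset.mul_sum]
        refine Finset.sum_congr rfl fun x _ => ?_
        simp only [sum_chi_add_left, mul_ite, mul_zero, Finset.sum_ite_eq, Finset.mem_univ, if_true]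
        field_simp

theorem sq_eq_one_of_boolean {f : (Fin n → ZMod 2) → ℝ} (hf : ∀ x, f x = 1 ∨ f x = -1)
    (x : Fin n → ZMod 2) : f x ^ 2 = 1 := by
  rcases hf x with h | h <;> simp [h]

theorem sum_fhat_mul_fhat_add_of_ne_zero {f : (Fin n → ZMod 2) → ℝ}
    (hf : ∀ x, f x = 1 ∨ f x = -1) {δ : Fin n → ZMod 2} (hδ : δ ≠ 0) :
    ∑ γ, fhat f γ * fhat f (γ + δ) = 0 := by
  simp [sum_fhat_mul_fhat_add, sq_eq_one_of_boolean hf, sum_chi_of_ne_zero hδ]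

theorem sum_fhat_sq {f : (Fin n → ZMod 2) → ℝ} (hf : ∀ x, f x = 1 ∨ f x = -1) :
    ∑ γ, fhat f γ ^ 2 = 1 := by
  have h := sum_fhat_mul_fhat_add f 0
  simp only [add_zero, sq_eq_one_of_boolean hf, one_mul] at h
  simp only [sq, h]
  simp [chi]

theorem one_le_mul_spectralNorm₁ {f : (Fin n → ZMod 2) → ℝ} (hf : ∀ x, f x = 1 ∨ f x = -1)
    {a : ℝ} (ha : ∀ γ, |fhat f γ| ≤ a) : 1 ≤ a * spectralNorm₁ f := by
  rw [← sum_fhat_sq hf, spectralNorm₁, Finset.mul_sum]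
  refine Finset.sum_le_sum fun γ _ => ?_
  rw [← sq_abs, sq]
  exact mul_le_mul_of_nonneg_right (ha γ) (abs_nonneg _)

theorem one_le_spectralNorm₁ {f : (Fin n → ZMod 2) → ℝ} (hf : ∀ x, f x = 1 ∨ f x = -1) :
    1 ≤ spectralNorm₁ f := by
  have h := one_le_mul_spectralNorm₁ hf (a := spectralNorm₁ f) fun γ =>
    Finset.single_le_sum (f := fun γ => |fhat f γ|) (fun _ _ => abs_nonneg _) (Finset.mem_univ γ)
  have h0 : 0 ≤ spectralNorm₁ f := Finset.sum_nonneg fun _ _ => abs_nonneg _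
  nlinarith

theorem eq_mul_chi_of_fhat_sq_eq_one {f : (Fin n → ZMod 2) → ℝ} (hf : ∀ x, f x = 1 ∨ f x = -1)
    {α : Fin n → ZMod 2} (hα : fhat f α ^ 2 = 1) (x : Fin n → ZMod 2) :
    f x = fhat f α * chi α x := by
  have h2 : (2 : ℝ) ^ n ≠ 0 := by positivity
  have hsum : ∑ x, f x * chi α x = 2 ^ n * fhat f α := by
    rw [fhat, mul_inv_cancel_left₀ h2]
  have hzero : ∑ x, (f x - fhat f α * chi α x) ^ 2 = 0 := by
    have hterm : ∀ x, (f x - fhat f α * chi α x) ^ 2 = 2 - 2 * fhat f α * (f x * chi α x) := by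
      intro x
      have h1 := sq_eq_one_of_boolean hf x
      have h3 := chi_mul_self α x
      linear_combination h1 + fhat f α ^ 2 * h3 + hα
    simp only [hterm, Finset.sum_sub_distrib, ← Finset.mul_sum, hsum]
    rw [Finset.sum_const, Finset.card_univ, nsmul_eq_mul, card_cube]
    linear_combination -2 * 2 ^ n * hα
  have hx := (Finset.sum_eq_zero_iff_of_nonneg fun x _ => sq_nonneg _).mp hzero x
    (Finset.mem_univ x)
  exact sub_eq_zero.mp (pow_eq_zero_iff two_ne_zero |>.mp hx)

/-- For `χ_δ(v) = -1` and `σ = ±1`, the `v`-periodic extension of the restriction of `f` to the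
affine hyperplane `χ_δ = σ`. -/
noncomputable def periodize (f : (Fin n → ZMod 2) → ℝ) (δ v : Fin n → ZMod 2) (σ : ℝ)
    (x : Fin n → ZMod 2) : ℝ :=
  (f x + f (x + v)) / 2 + σ * chi δ x * ((f x - f (x + v)) / 2)

theorem periodize_of_eq (f : (Fin n → ZMod 2) → ℝ) {δ v x : Fin n → ZMod 2} {σ : ℝ}
    (hσ : σ = 1 ∨ σ = -1) (hx : chi δ x = σ) : periodize f δ v σ x = f x := by
  unfold periodize
  rw [hx]
  rcases hσ with h | h <;> rw [h] <;> ring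

theorem periodize_boolean {f : (Fin n → ZMod 2) → ℝ} (hf : ∀ x, f x = 1 ∨ f x = -1)
    (δ v : Fin n → ZMod 2) {σ : ℝ} (hσ : σ = 1 ∨ σ = -1) (x : Fin n → ZMod 2) :
    periodize f δ v σ x = 1 ∨ periodize f δ v σ x = -1 := by
  unfold periodize
  rcases hf x with h1 | h1 <;> rcases hf (x + v) with h2 | h2 <;>
    rcases chi_eq_one_or δ x with h3 | h3 <;> rcases hσ with h4 | h4 <;>
    norm_num [h1, h2, h3, h4]

theorem periodize_add (f : (Fin n → ZMod 2) → ℝ) {δ v : Fin n → ZMod 2} (hv : chi δ v = -1)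
    (σ : ℝ) (x : Fin n → ZMod 2) : periodize f δ v σ (x + v) = periodize f δ v σ x := by
  unfold periodize
  rw [add_add_cancel_cube, chi_add_right, hv]
  ring

theorem fhat_periodize (f : (Fin n → ZMod 2) → ℝ) {δ v : Fin n → ZMod 2} (hv : chi δ v = -1)
    (σ : ℝ) (γ : Fin n → ZMod 2) :
    fhat (periodize f δ v σ) γ = (1 + chi γ v) / 2 * (fhat f γ + σ * fhat f (γ + δ)) := by
  have shift : ∀ β, ∑ x, f (x + v) * chi β x = chi β v * ∑ x, f x * chi β x := by
    intro β
    rw [← sum_comp_add_right v, Finset.mul_sum]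
    refine Finset.sum_congr rfl fun x _ => ?_
    rw [add_add_cancel_cube, chi_add_right]
    ring
  have expand : ∑ x, periodize f δ v σ x * chi γ x =
      1 / 2 * ∑ x, f x * chi γ x + 1 / 2 * ∑ x, f (x + v) * chi γ x +
      σ / 2 * ∑ x, f x * chi (γ + δ) x - σ / 2 * ∑ x, f (x + v) * chi (γ + δ) x := by
    simp only [Finset.mul_sum, ← Finset.sum_add_distrib, ← Finset.sum_sub_distrib]
    refine Finset.sum_congr rfl fun x _ => ?_
    rw [periodize, chi_add_left]
    ring
  unfold fhat
  rw [expand, shift, shift, chi_add_left, hv]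
  ring

theorem spectralNorm₁_periodize (f : (Fin n → ZMod 2) → ℝ) {δ v : Fin n → ZMod 2}
    (hv : chi δ v = -1) {σ : ℝ} (hσ : σ = 1 ∨ σ = -1) :
    spectralNorm₁ (periodize f δ v σ) = 1 / 2 * ∑ γ, |fhat f γ + σ * fhat f (γ + δ)| := by
  have hterm : ∀ γ, |fhat (periodize f δ v σ) γ| =
      (1 + chi γ v) / 2 * |fhat f γ + σ * fhat f (γ + δ)| := by
    intro γ
    rw [fhat_periodize f hv, abs_mul, abs_of_nonneg]
    rcases chi_eq_one_or γ v with h | h <;> norm_num [h]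
  have hsymm : ∀ γ, |fhat f (γ + δ) + σ * fhat f (γ + δ + δ)| =
      |fhat f γ + σ * fhat f (γ + δ)| := by
    intro γ
    rw [add_add_cancel_cube]
    rcases hσ with h | h <;> rw [h]
    · congr 1
      ring
    · rw [← abs_neg]
      congr 1
      ring
  have hswap : spectralNorm₁ (periodize f δ v σ) =
      ∑ γ, (1 - chi γ v) / 2 * |fhat f γ + σ * fhat f (γ + δ)| := by
    rw [spectralNorm₁, ← sum_comp_add_right δ]
    refine Finset.sum_congr rfl fun γ _ => ?_
    rw [hterm, hsymm, chi_add_left, hv]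
    ring
  have hdirect : spectralNorm₁ (periodize f δ v σ) =
      ∑ γ, (1 + chi γ v) / 2 * |fhat f γ + σ * fhat f (γ + δ)| :=
    Finset.sum_congr rfl fun γ _ => hterm γ
  have hadd : spectralNorm₁ (periodize f δ v σ) + spectralNorm₁ (periodize f δ v σ) =
      ∑ γ, |fhat f γ + σ * fhat f (γ + δ)| := by
    nth_rewrite 1 [hdirect]
    rw [hswap, ← Finset.sum_add_distrib]
    refine Finset.sum_congr rfl fun γ _ => ?_
    ring
  linarith

theorem spectralNorm₁_eq_half_sum (f : (Fin n → ZMod 2) → ℝ) (δ : Fin n → ZMod 2) :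
    spectralNorm₁ f = 1 / 2 * ∑ γ, (|fhat f γ| + |fhat f (γ + δ)|) := by
  rw [Finset.sum_add_distrib, sum_comp_add_right δ fun γ => |fhat f γ|, spectralNorm₁]
  ring

theorem abs_sign_mul {σ : ℝ} (hσ : σ = 1 ∨ σ = -1) (y : ℝ) : |σ * y| = |y| := by
  rcases hσ with h | h <;> simp [h]

theorem spectralNorm₁_periodize_le (f : (Fin n → ZMod 2) → ℝ) {δ v : Fin n → ZMod 2}
    (hv : chi δ v = -1) {σ : ℝ} (hσ : σ = 1 ∨ σ = -1) :
    spectralNorm₁ (periodize f δ v σ) ≤ spectralNorm₁ f := by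
  rw [spectralNorm₁_periodize f hv hσ, spectralNorm₁_eq_half_sum f δ]
  gcongr with γ
  rw [← abs_sign_mul hσ (fhat f (γ + δ))]
  exact abs_add_le _ _

theorem neg_two_mul_le_mul_abs_sub {b x y : ℝ} (hx : |x| ≤ b) (hy : |y| ≤ b) :
    -2 * (x * y) ≤ b * (|x| + |y| - |x + y|) := by
  obtain ⟨hx1, hx2⟩ := abs_le.mp hx
  obtain ⟨hy1, hy2⟩ := abs_le.mp hy
  rcases abs_cases x with ⟨h1, h1'⟩ | ⟨h1, h1'⟩ <;> rcases abs_cases y with ⟨h2, h2'⟩ | ⟨h2, h2'⟩ <;>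
    rcases abs_cases (x + y) with ⟨h3, h3'⟩ | ⟨h3, h3'⟩ <;> rw [h1, h2, h3] <;> nlinarith

/-- Let `α` carry the largest and `β` the second largest Fourier coefficient of a Boolean function.
On the side of `α + β` where these two reinforce each other, the spectral norm drops
by `2|f̂(α)|`. -/
theorem spectralNorm₁_periodize_le_sub {f : (Fin n → ZMod 2) → ℝ}
    (hf : ∀ x, f x = 1 ∨ f x = -1) {α β v : Fin n → ZMod 2} (hαβ : α ≠ β)
    (hv : chi (α + β) v = -1) {σ : ℝ} (hσ : σ = 1 ∨ σ = -1)
    (hsign : σ * (fhat f α * fhat f β) = |fhat f α| * |fhat f β|)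
    (hβ : fhat f β ≠ 0) (hmax : ∀ γ, γ ≠ α → |fhat f γ| ≤ |fhat f β|) :
    spectralNorm₁ (periodize f (α + β) v σ) ≤ spectralNorm₁ f - 2 * |fhat f α| := by
  set δ := α + β with hδ
  have hδ0 : δ ≠ 0 := fun h => hαβ (add_eq_zero_cube.mp h)
  have hαδ : α + δ = β := by rw [hδ, ← add_assoc, add_self_cube, zero_add]
  have hβδ : β + δ = α := by rw [hδ, add_comm α β, ← add_assoc, add_self_cube, zero_add]
  set loss : (Fin n → ZMod 2) → ℝ := fun γ =>
    |fhat f γ| + |fhat f (γ + δ)| - |fhat f γ + σ * fhat f (γ + δ)| with hloss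
  have hloss_nonneg : ∀ γ, 0 ≤ loss γ := by
    intro γ
    have h := abs_add_le (fhat f γ) (σ * fhat f (γ + δ))
    rw [abs_sign_mul hσ] at h
    simp only [hloss]
    linarith
  have hdrop : spectralNorm₁ f - spectralNorm₁ (periodize f δ v σ) = 1 / 2 * ∑ γ, loss γ := by
    rw [spectralNorm₁_periodize f hv hσ, spectralNorm₁_eq_half_sum f δ]
    simp only [hloss, Finset.sum_sub_distrib]
    ring
  have hsplit : ∀ F : (Fin n → ZMod 2) → ℝ,
      ∑ γ, F γ = F α + (F β + ∑ γ ∈ (Finset.univ.erase α).erase β, F γ) := by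
    intro F
    rw [Finset.add_sum_erase _ _ (Finset.mem_erase.mpr ⟨hαβ.symm, Finset.mem_univ _⟩),
      Finset.add_sum_erase _ _ (Finset.mem_univ _)]
  have hcorr := sum_fhat_mul_fhat_add_of_ne_zero hf hδ0
  rw [hsplit, hαδ, hβδ] at hcorr
  have hrest : -2 * σ * ∑ γ ∈ (Finset.univ.erase α).erase β, fhat f γ * fhat f (γ + δ) ≤
      |fhat f β| * ∑ γ ∈ (Finset.univ.erase α).erase β, loss γ := by
    rw [Finset.mul_sum, Finset.mul_sum]
    refine Finset.sum_le_sum fun γ hγ => ?_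
    simp only [Finset.mem_erase, Finset.mem_univ, and_true] at hγ
    have hγδ : γ + δ ≠ α := by
      intro h
      apply hγ.1
      rw [← add_add_cancel_cube γ δ, h, hαδ]
    have h := neg_two_mul_le_mul_abs_sub (hmax γ hγ.2)
      (y := σ * fhat f (γ + δ)) (by rw [abs_sign_mul hσ]; exact hmax _ hγδ)
    rw [abs_sign_mul hσ] at h
    calc -2 * σ * (fhat f γ * fhat f (γ + δ)) = -2 * (fhat f γ * (σ * fhat f (γ + δ))) := by ring
      _ ≤ _ := h
  have htotal : ∑ γ ∈ (Finset.univ.erase α).erase β, loss γ ≤ ∑ γ, loss γ := by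
    rw [hsplit loss]
    have h1 := hloss_nonneg α
    have h2 := hloss_nonneg β
    linarith
  have hβ0 : 0 < |fhat f β| := abs_pos.mpr hβ
  have hbound : 4 * |fhat f α| ≤ ∑ γ ∈ (Finset.univ.erase α).erase β, loss γ := by
    refine le_of_mul_le_mul_left ?_ hβ0
    calc |fhat f β| * (4 * |fhat f α|) = 4 * (σ * (fhat f α * fhat f β)) := by rw [hsign]; ring
      _ = -2 * σ * ∑ γ ∈ (Finset.univ.erase α).erase β, fhat f γ * fhat f (γ + δ) := by
        linear_combination 2 * σ * hcorr
      _ ≤ _ := hrest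
  linarith

theorem exists_sign_mul_eq_abs (x y : ℝ) : ∃ σ : ℝ, (σ = 1 ∨ σ = -1) ∧ σ * (x * y) = |x| * |y| := by
  rw [← abs_mul]
  rcases abs_choice (x * y) with h | h
  · exact ⟨1, Or.inl rfl, by rw [h, one_mul]⟩
  · exact ⟨-1, Or.inr rfl, by rw [h, neg_one_mul]⟩

/-- A Boolean function is a signed character, or some affine hyperplane reduces its spectral norm
by at least `2 / ‖f̂‖₁`. -/
theorem signed_character_or_exists_drop {f : (Fin n → ZMod 2) → ℝ}
    (hf : ∀ x, f x = 1 ∨ f x = -1) :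
    (∃ (α : Fin n → ZMod 2) (c : ℝ), (c = 1 ∨ c = -1) ∧ ∀ x, f x = c * chi α x) ∨
      ∃ (δ v : Fin n → ZMod 2) (σ : ℝ), chi δ v = -1 ∧ (σ = 1 ∨ σ = -1) ∧
        spectralNorm₁ (periodize f δ v σ) ≤ spectralNorm₁ f - 2 / spectralNorm₁ f := by
  obtain ⟨α, -, hα⟩ := Finset.exists_max_image Finset.univ (fun γ => |fhat f γ|)
    Finset.univ_nonempty
  by_cases hother : ∃ β, β ≠ α ∧ fhat f β ≠ 0
  · right
    obtain ⟨β₀, hβ₀, hβ₀'⟩ := hother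
    obtain ⟨β, hβα, hβ⟩ := Finset.exists_max_image (Finset.univ.erase α) (fun γ => |fhat f γ|)
      ⟨β₀, Finset.mem_erase.mpr ⟨hβ₀, Finset.mem_univ _⟩⟩
    have hne : α ≠ β := (Finset.ne_of_mem_erase hβα).symm
    have hmax : ∀ γ, γ ≠ α → |fhat f γ| ≤ |fhat f β| := fun γ hγ =>
      hβ γ (Finset.mem_erase.mpr ⟨hγ, Finset.mem_univ _⟩)
    have hβ0 : fhat f β ≠ 0 := abs_pos.mp ((abs_pos.mpr hβ₀').trans_le (hmax β₀ hβ₀))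
    obtain ⟨v, hv⟩ := exists_chi_eq_neg_one (α := α + β) fun h => hne (add_eq_zero_cube.mp h)
    obtain ⟨σ, hσ, hsign⟩ := exists_sign_mul_eq_abs (fhat f α) (fhat f β)
    refine ⟨α + β, v, σ, hv, hσ, ?_⟩
    have hdrop := spectralNorm₁_periodize_le_sub hf hne hv hσ hsign hβ0 hmax
    have hlarge := one_le_mul_spectralNorm₁ hf fun γ => hα γ (Finset.mem_univ γ)
    have hpos : 0 < spectralNorm₁ f := zero_lt_one.trans_le (one_le_spectralNorm₁ hf)
    have hdiv : 2 / spectralNorm₁ f ≤ 2 * |fhat f α| := by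
      rw [div_le_iff₀ hpos]
      linarith
    linarith
  · left
    push Not at hother
    have hsq : fhat f α ^ 2 = 1 := by
      rw [← sum_fhat_sq hf, Finset.sum_eq_single α]
      · intro β _ hβ
        simp [hother β hβ]
      · simp
    exact ⟨α, fhat f α, by simpa using hsq, eq_mul_chi_of_fhat_sq_eq_one hf hsq⟩

end Fourier

namespace PDT

variable {n : ℕ}

theorem eval_node (α : Fin n → ZMod 2) (t₀ t₁ : PDT n) (x : Fin n → ZMod 2) :
    (node α t₀ t₁).eval x = if chi α x = 1 then t₀.eval x else t₁.eval x := by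
  have h : chi α x = 1 ↔ (∑ i, α i * x i : ZMod 2) = 0 := by
    unfold chi
    split_ifs with h <;> norm_num [h]
  simp only [eval, h]

theorem eval_boolean (T : PDT n) (x : Fin n → ZMod 2) : T.eval x = 1 ∨ T.eval x = -1 := by
  induction T with
  | leaf b => cases b <;> simp [eval]
  | node α t₀ t₁ h₀ h₁ =>
    rw [eval_node]
    split_ifs <;> assumption

theorem size_le_two_pow_depth (T : PDT n) : T.size ≤ 2 ^ T.depth := by
  induction T with
  | leaf b => simp [size, depth]
  | node α t₀ t₁ h₀ h₁ =>
    have h₀' : 2 ^ t₀.depth ≤ 2 ^ max t₀.depth t₁.depth :=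
      Nat.pow_le_pow_right two_pos (le_max_left _ _)
    have h₁' : 2 ^ t₁.depth ≤ 2 ^ max t₀.depth t₁.depth :=
      Nat.pow_le_pow_right two_pos (le_max_right _ _)
    simp only [size, depth, pow_succ]
    omega

theorem exists_eval_add (T : PDT n) (v : Fin n → ZMod 2) :
    ∃ S : PDT n, S.depth = T.depth ∧ ∀ x, S.eval x = T.eval (x + v) := by
  induction T with
  | leaf b => exact ⟨leaf b, rfl, fun x => rfl⟩
  | node α t₀ t₁ h₀ h₁ =>
    obtain ⟨s₀, hd₀, he₀⟩ := h₀
    obtain ⟨s₁, hd₁, he₁⟩ := h₁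
    rcases chi_eq_one_or α v with hv | hv
    · refine ⟨node α s₀ s₁, by simp [depth, hd₀, hd₁], fun x => ?_⟩
      simp [eval_node, chi_add_right, hv, he₀, he₁]
    · refine ⟨node α s₁ s₀, by simp [depth, hd₀, hd₁, max_comm], fun x => ?_⟩
      rcases chi_eq_one_or α x with hx | hx <;>
        norm_num [eval_node, chi_add_right, hv, hx, he₀, he₁]

theorem exists_eval_eq_signed_character (α : Fin n → ZMod 2) {c : ℝ} (hc : c = 1 ∨ c = -1) :
    ∃ T : PDT n, T.depth = 1 ∧ ∀ x, T.eval x = c * chi α x := by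
  rcases hc with rfl | rfl
  · refine ⟨node α (leaf true) (leaf false), rfl, fun x => ?_⟩
    rw [eval_node]
    rcases chi_eq_one_or α x with hx | hx <;> norm_num [eval, hx]
  · refine ⟨node α (leaf false) (leaf true), rfl, fun x => ?_⟩
    rw [eval_node]
    rcases chi_eq_one_or α x with hx | hx <;> norm_num [eval, hx]

/-- The number of inputs on which `T` differs from `f`. -/
noncomputable def error (T : PDT n) (f : (Fin n → ZMod 2) → ℝ) : ℝ :=
  ∑ x, if f x = T.eval x then 0 else 1

theorem error_le (T : PDT n) (f : (Fin n → ZMod 2) → ℝ) : T.error f ≤ 2 ^ n := by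
  rw [error, ← card_cube, ← Finset.card_univ, ← nsmul_one, ← Finset.sum_const]
  refine Finset.sum_le_sum fun x _ => ?_
  split_ifs <;> norm_num

theorem error_eq_card (T : PDT n) (f : (Fin n → ZMod 2) → ℝ) :
    T.error f = Nat.card {x // f x ≠ T.eval x} := by
  classical
  rw [Nat.card_eq_fintype_card, Fintype.card_subtype, Finset.card_filter, error]
  push_cast
  exact Finset.sum_congr rfl fun x _ => by split_ifs <;> simp_all

/-- Either `T` or its translate by `v` makes at most half of the errors of `T` on the affine
hyperplane `χ_δ = σ`. -/
theorem exists_error_on_hyperplane_le (T : PDT n) (f : (Fin n → ZMod 2) → ℝ)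
    {δ v : Fin n → ZMod 2} (hv : chi δ v = -1) {σ : ℝ} (hσ : σ = 1 ∨ σ = -1) :
    ∃ S : PDT n, S.depth = T.depth ∧
      ∑ x, (if chi δ x = σ then (if f x = S.eval x then 0 else 1) else 0) ≤
        T.error (periodize f δ v σ) / 2 := by
  obtain ⟨S, hSd, hSe⟩ := T.exists_eval_add v
  set F := periodize f δ v σ with hF
  have hon : ∀ (R : PDT n) (x : Fin n → ZMod 2),
      (if chi δ x = σ then (if f x = R.eval x then 0 else 1) else 0 : ℝ) =
        if chi δ x = σ then (if F x = R.eval x then 0 else 1) else 0 := by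
    intro R x
    by_cases hx : chi δ x = σ
    · rw [hF, periodize_of_eq f hσ hx]
    · simp only [hx, if_false]
  have htranslate : ∑ x, (if chi δ x = σ then (if f x = S.eval x then 0 else 1) else 0 : ℝ) =
      ∑ x, if chi δ x = σ then 0 else (if F x = T.eval x then 0 else 1) := by
    rw [← sum_comp_add_right v]
    refine Finset.sum_congr rfl fun x _ => ?_
    rw [hon, hSe, add_add_cancel_cube, hF, periodize_add f hv, chi_add_right, hv]
    rcases chi_eq_one_or δ x with hx | hx <;> rcases hσ with h | h <;> norm_num [hx, h]
  have hsum : ∑ x, (if chi δ x = σ then (if f x = T.eval x then 0 else 1) else 0 : ℝ) +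
      ∑ x, (if chi δ x = σ then (if f x = S.eval x then 0 else 1) else 0 : ℝ) = T.error F := by
    rw [htranslate, ← Finset.sum_add_distrib, error]
    refine Finset.sum_congr rfl fun x _ => ?_
    rw [hon]
    split_ifs <;> simp
  rcases le_total
    (∑ x, (if chi δ x = σ then (if f x = T.eval x then 0 else 1) else 0 : ℝ))
    (∑ x, (if chi δ x = σ then (if f x = S.eval x then 0 else 1) else 0 : ℝ)) with h | h
  · exact ⟨T, rfl, by linarith⟩
  · exact ⟨S, hSd, by linarith⟩

theorem exists_error_le_average (f : (Fin n → ZMod 2) → ℝ) {δ v : Fin n → ZMod 2}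
    (hv : chi δ v = -1) (T₀ T₁ : PDT n) :
    ∃ T : PDT n, T.depth = max T₀.depth T₁.depth + 1 ∧
      T.error f ≤ (T₀.error (periodize f δ v 1) + T₁.error (periodize f δ v (-1))) / 2 := by
  obtain ⟨S₀, hd₀, he₀⟩ := T₀.exists_error_on_hyperplane_le f hv (Or.inl rfl)
  obtain ⟨S₁, hd₁, he₁⟩ := T₁.exists_error_on_hyperplane_le f hv (Or.inr rfl)
  refine ⟨node δ S₀ S₁, by simp [depth, hd₀, hd₁], ?_⟩
  have hsum : (node δ S₀ S₁).error f =
      ∑ x, (if chi δ x = 1 then (if f x = S₀.eval x then 0 else 1) else 0) +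
      ∑ x, (if chi δ x = -1 then (if f x = S₁.eval x then 0 else 1) else 0) := by
    rw [error, ← Finset.sum_add_distrib]
    refine Finset.sum_congr rfl fun x _ => ?_
    rcases chi_eq_one_or δ x with hx | hx <;> norm_num [eval_node, hx]
  linarith

theorem exists_error_le {A : ℝ} (D k : ℕ) (f : (Fin n → ZMod 2) → ℝ)
    (hf : ∀ x, f x = 1 ∨ f x = -1) (hA : spectralNorm₁ f ≤ A)
    (hk : spectralNorm₁ f < 1 + 2 * k / A) :
    ∃ T : PDT n, T.depth ≤ D ∧ T.error f ≤ 3 ^ k * (2 / 3) ^ D * 2 ^ n := by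
  induction D generalizing k f with
  | zero =>
    refine ⟨leaf true, le_rfl, (error_le _ f).trans ?_⟩
    rw [pow_zero, mul_one]
    exact le_mul_of_one_le_left (by positivity) (one_le_pow₀ (by norm_num))
  | succ D ih =>
    have hone := one_le_spectralNorm₁ hf
    cases k with
    | zero =>
      simp only [Nat.cast_zero, mul_zero, zero_div, add_zero] at hk
      linarith
    | succ k =>
      rcases signed_character_or_exists_drop hf with ⟨α, c, hc, hfc⟩ | ⟨δ, v, σ, hv, hσ, hdrop⟩
      · obtain ⟨T, hd, he⟩ := exists_eval_eq_signed_character α hc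
        refine ⟨T, by omega, ?_⟩
        have h0 : T.error f = 0 := by simp [error, hfc, he]
        rw [h0]
        positivity
      · have hσ' : -σ = 1 ∨ -σ = -1 := by
          rcases hσ with h | h <;> simp [h]
        have hle := spectralNorm₁_periodize_le f hv hσ
        have hle' := spectralNorm₁_periodize_le f hv hσ'
        have hdiv : 2 / A ≤ 2 / spectralNorm₁ f :=
          div_le_div_of_nonneg_left zero_le_two (by linarith) hA
        have hk' : 1 + 2 * ((k + 1 : ℕ) : ℝ) / A = 1 + 2 * k / A + 2 / A := by
          push_cast
          ring
        obtain ⟨T, hTd, hTe⟩ := ih k (periodize f δ v σ) (periodize_boolean hf δ v hσ)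
          (hle.trans hA) (by linarith)
        obtain ⟨T', hTd', hTe'⟩ := ih (k + 1) (periodize f δ v (-σ)) (periodize_boolean hf δ v hσ')
          (hle'.trans hA) (hle'.trans_lt hk)
        have harith : (3 ^ k * (2 / 3) ^ D * 2 ^ n + 3 ^ (k + 1) * (2 / 3) ^ D * 2 ^ n) / 2 =
            (3 : ℝ) ^ (k + 1) * (2 / 3) ^ (D + 1) * 2 ^ n := by ring
        rcases hσ with rfl | rfl
        · obtain ⟨R, hRd, hRe⟩ := exists_error_le_average f hv T T'
          exact ⟨R, by omega, by linarith⟩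
        · rw [neg_neg] at hTe'
          obtain ⟨R, hRd, hRe⟩ := exists_error_le_average f hv T' T
          exact ⟨R, by omega, by linarith⟩

end PDT

theorem three_pow_mul_two_thirds_pow_le {k D : ℕ} {ε : ℝ} (hε : 0 < ε)
    (hD : 2 * (2 * k + Real.logb 2 (1 / ε)) ≤ D) : (3 : ℝ) ^ k * (2 / 3) ^ D ≤ ε := by
  have hbase : (2 / 3 : ℝ) ≤ 2 ^ (-(1 / 2) : ℝ) := by
    rw [Real.rpow_neg zero_le_two, ← Real.sqrt_eq_rpow, le_inv_comm₀ (by norm_num) (by positivity),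
      Real.sqrt_le_left (by norm_num)]
    norm_num
  have hpow : (2 / 3 : ℝ) ^ D ≤ 2 ^ (-(2 * k) + Real.logb 2 ε) := by
    calc (2 / 3 : ℝ) ^ D ≤ ((2 : ℝ) ^ (-(1 / 2) : ℝ)) ^ D := by gcongr
      _ = 2 ^ (-(1 / 2) * D : ℝ) := by rw [Real.rpow_mul zero_le_two, Real.rpow_natCast]
      _ ≤ _ := by
        apply Real.rpow_le_rpow_of_exponent_le one_le_two
        rw [one_div, Real.logb_inv] at hD
        linarith
  have hsplit : (2 : ℝ) ^ (-(2 * k) + Real.logb 2 ε) = (4 ^ k)⁻¹ * ε := by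
    rw [Real.rpow_add two_pos, Real.rpow_logb two_pos (by norm_num) hε, Real.rpow_neg zero_le_two,
      Real.rpow_mul zero_le_two, Real.rpow_natCast]
    norm_num
  calc (3 : ℝ) ^ k * (2 / 3) ^ D ≤ 4 ^ k * ((4 ^ k)⁻¹ * ε) := by
        rw [← hsplit]
        gcongr
        norm_num
    _ = ε := mul_inv_cancel_left₀ (by positivity) ε

/-- **Theorem 1.4** (existential part): there is a universal constant `C > 0` such
that every Boolean function `f` with spectral norm at most `A` is `ε`-approximated
(under the uniform distribution) by a Boolean function computed by a parity
decision tree of depth at most `C(A² + log₂(1/ε))` and size at most `2^{CA²}/ε²`. -/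
theorem approx_pdt_of_small_spectral_norm :
    ∃ C : ℝ, 0 < C ∧
      ∀ (n : ℕ) (f : (Fin n → ZMod 2) → ℝ),
        (∀ x, f x = 1 ∨ f x = -1) →
        ∀ A : ℝ, (∑ α : Fin n → ZMod 2, |fhat f α|) ≤ A →
        ∀ ε : ℝ, 0 < ε → ε < 1 →
        ∃ (g : (Fin n → ZMod 2) → ℝ) (T : PDT n),
          (∀ x, g x = 1 ∨ g x = -1) ∧
          (∀ x, T.eval x = g x) ∧
          (T.depth : ℝ) ≤ C * (A ^ 2 + Real.logb 2 (1 / ε)) ∧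
          (T.size : ℝ) ≤ (2 : ℝ) ^ (C * A ^ 2) / ε ^ 2 ∧
          (Nat.card {x : Fin n → ZMod 2 // f x ≠ g x} : ℝ) / 2 ^ n ≤ ε := by
  refine ⟨7, by norm_num, fun n f hf A hA ε hε hε1 => ?_⟩
  have hA1 : 1 ≤ A := (one_le_spectralNorm₁ hf).trans hA
  have hlog : 0 ≤ Real.logb 2 (1 / ε) :=
    Real.logb_nonneg one_lt_two (by rw [le_div_iff₀ hε]; linarith)
  set k : ℕ := ⌊A ^ 2 / 2⌋₊ + 1 with hk
  have hk_lower : A ^ 2 / 2 < k := by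
    rw [hk]
    push_cast
    exact Nat.lt_floor_add_one _
  have hk_upper : (k : ℝ) ≤ 3 / 2 * A ^ 2 := by
    have h := Nat.floor_le (a := A ^ 2 / 2) (by positivity)
    rw [hk]
    push_cast
    nlinarith
  set D : ℕ := ⌈2 * (2 * k + Real.logb 2 (1 / ε))⌉₊ with hD
  have hD_lower : 2 * (2 * k + Real.logb 2 (1 / ε)) ≤ D := Nat.le_ceil _
  have hD_upper : (D : ℝ) ≤ 7 * A ^ 2 + 2 * Real.logb 2 (1 / ε) := by
    have h := Nat.ceil_lt_add_one (a := 2 * (2 * k + Real.logb 2 (1 / ε))) (by positivity)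
    rw [← hD] at h
    nlinarith
  have hnorm : spectralNorm₁ f < 1 + 2 * k / A := by
    have h : A < 2 * k / A := by
      rw [lt_div_iff₀ (by linarith)]
      linarith
    have hA' : spectralNorm₁ f ≤ A := hA
    linarith
  obtain ⟨T, hTd, hTe⟩ := PDT.exists_error_le D k f hf hA hnorm
  have hTd' : (T.depth : ℝ) ≤ D := by exact_mod_cast hTd
  refine ⟨T.eval, T, T.eval_boolean, fun x => rfl, by linarith, ?_, ?_⟩
  · calc (T.size : ℝ) ≤ 2 ^ T.depth := by exact_mod_cast T.size_le_two_pow_depth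
      _ = (2 : ℝ) ^ (T.depth : ℝ) := (Real.rpow_natCast _ _).symm
      _ ≤ 2 ^ (7 * A ^ 2 + Real.logb 2 (1 / ε) * (2 : ℕ)) :=
        Real.rpow_le_rpow_of_exponent_le one_le_two (by push_cast; linarith)
      _ = 2 ^ (7 * A ^ 2) / ε ^ 2 := by
        rw [Real.rpow_add two_pos, Real.rpow_mul zero_le_two (Real.logb 2 (1 / ε)),
          Real.rpow_logb two_pos (by norm_num) (by positivity), Real.rpow_natCast, one_div,
          inv_pow, div_eq_mul_inv]
  · rw [← PDT.error_eq_card, div_le_iff₀ (by positivity)]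
    refine hTe.trans ?_
    gcongr
    exact three_pow_mul_two_thirds_pow_le hε hD_lower
end
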